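/- arXiv:1610.03310 — 2 statements merged into one kernel-verified Lean document; each statement's English description precedes it below -/
import Mathlib

section
/- Let R ∈ ℝ_{1,3} be a constant element, ρ : ℝ⁴ → (0,∞) and S : ℝ⁴ → ℝ differentiable functions, and define ψ₀(x) = ρ(x)^{1/2} R and ψ(x) = ψ₀(x) · e^{S(x)γ21}. Then for every x ∈ ℝ⁴: Σ_μ γ^μ (∂_μ ψ)(x) γ21 = ½ (Σ_μ γ^μ ∂_μ (ln ρ)(x)) ψ(x) γ21 − (Σ_μ γ^μ ∂_μ S(x)) ψ(x); that is, ∂ψ γ21 = (∂ ln ψ₀) ψ γ21 − (∂S) ψ with ∂ ln ψ₀ = ½ ∂ ln ρ. -/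
noncomputable section
open CliffordAlgebra

/-- The Minkowski quadratic form `Q(x) = x₀² - x₁² - x₂² - x₃²` on `ℝ⁴`. -/
def Qmink : QuadraticForm ℝ (Fin 4 → ℝ) :=
  QuadraticMap.weightedSumSquares ℝ ![(1 : ℝ), -1, -1, -1]

/-- The spacetime algebra `ℝ_{1,3}`. -/
abbrev STA : Type := CliffordAlgebra Qmink

/-- The generating vectors `γ_μ = ι(e_μ)`. -/
def γ (μ : Fin 4) : STA := ι Qmink (Pi.single μ 1)

/-- The signs `η^{μμ} = diag(1,-1,-1,-1)`. -/
def ηsgn (μ : Fin 4) : ℝ := if μ = 0 then 1 else -1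

/-- The raised-index vectors `γ^μ := η^{μμ} γ_μ`. -/
def γup (μ : Fin 4) : STA := ηsgn μ • γ μ

/-- The bivector `γ21 := γ₂γ₁` (it squares to `-1`). -/
def γ21 : STA := γ 2 * γ 1

/-- `e^{θ γ21} := cos θ + (sin θ) γ21`. -/
def expG21 (θ : ℝ) : STA := algebraMap ℝ STA (Real.cos θ) + Real.sin θ • γ21

/-- The partial derivative `∂_μ f` of a function `f : ℝ⁴ → ℝ` at `x`. -/
def pd (μ : Fin 4) (f : (Fin 4 → ℝ) → ℝ) (x : Fin 4 → ℝ) : ℝ :=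
  deriv (fun t : ℝ => f (x + t • (Pi.single μ 1 : Fin 4 → ℝ))) 0

/-- `f' ` is the `μ`-th partial derivative of the spacetime-algebra valued field `f`
(tested against all real-linear functionals, since `STA` carries no topology). -/
def HasPDeriv (μ : Fin 4) (f f' : (Fin 4 → ℝ) → STA) : Prop :=
  ∀ (L : STA →ₗ[ℝ] ℝ) (x : Fin 4 → ℝ),
    HasDerivAt (fun t : ℝ => L (f (x + t • (Pi.single μ 1 : Fin 4 → ℝ)))) (L (f' x)) 0

theorem Qmink_apply (v : Fin 4 → ℝ) : Qmink v = v 0 ^ 2 - v 1 ^ 2 - v 2 ^ 2 - v 3 ^ 2 := by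
  simp only [Qmink, QuadraticMap.weightedSumSquares_apply, Fin.sum_univ_four]
  simp
  ring

theorem γ_mul_self (μ : Fin 4) (hμ : μ ≠ 0) : γ μ * γ μ = -1 := by
  have hQ : Qmink (Pi.single μ 1) = -1 := by
    rw [Qmink_apply]
    fin_cases μ <;> simp_all
  rw [γ, ι_sq_scalar, hQ, map_neg, map_one]

theorem γ_one_mul_γ_two : γ 1 * γ 2 = -(γ 2 * γ 1) := by
  have hQ : QuadraticMap.polar Qmink (Pi.single 1 1) (Pi.single 2 1) = 0 := by
    simp [QuadraticMap.polar, Qmink_apply]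
  rw [eq_neg_iff_add_eq_zero, γ, γ, ι_mul_ι_add_swap, hQ, map_zero]

theorem γ21_mul_self : γ21 * γ21 = -1 := by
  calc γ21 * γ21 = γ 2 * (γ 1 * γ 2) * γ 1 := by simp only [γ21, mul_assoc]
    _ = -((γ 2 * γ 2) * (γ 1 * γ 1)) := by
      rw [γ_one_mul_γ_two]; simp only [mul_neg, neg_mul, mul_assoc]
    _ = -1 := by rw [γ_mul_self 2 (by decide), γ_mul_self 1 (by decide)]; simp

theorem mul_expG21 (R : STA) (θ : ℝ) :
    R * expG21 θ = Real.cos θ • R + Real.sin θ • (R * γ21) := by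
  rw [expG21, mul_add, mul_smul_comm, ← Algebra.commutes, ← Algebra.smul_def]

theorem mul_expG21_mul_γ21 (R : STA) (θ : ℝ) :
    R * expG21 θ * γ21 = Real.cos θ • (R * γ21) - Real.sin θ • R := by
  rw [mul_expG21, add_mul, smul_mul_assoc, smul_mul_assoc, mul_assoc, γ21_mul_self, mul_neg_one,
    smul_neg, sub_eq_add_neg]

theorem HasPDeriv.unique {μ : Fin 4} {f f' f'' : (Fin 4 → ℝ) → STA}
    (h' : HasPDeriv μ f f') (h'' : HasPDeriv μ f f'') : f' = f'' := by
  funext x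
  rw [← sub_eq_zero, ← Module.forall_dual_apply_eq_zero_iff ℝ]
  intro L
  rw [map_sub, (h' L x).unique (h'' L x), sub_self]

theorem hasDerivAt_pd {f : (Fin 4 → ℝ) → ℝ} {x : Fin 4 → ℝ} (hf : DifferentiableAt ℝ f x)
    (μ : Fin 4) :
    HasDerivAt (fun t : ℝ => f (x + t • (Pi.single μ 1 : Fin 4 → ℝ))) (pd μ f x) 0 :=
  hf.lineDifferentiableAt.hasDerivAt

theorem pd_log {ρ : (Fin 4 → ℝ) → ℝ} {x : Fin 4 → ℝ} (hρ : DifferentiableAt ℝ ρ x)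
    (hx : ρ x ≠ 0) (μ : Fin 4) : pd μ (fun y => Real.log (ρ y)) x = pd μ ρ x / ρ x := by
  simpa [pd] using ((hasDerivAt_pd hρ μ).log (by simpa using hx)).deriv

/-- The partial derivatives of `ρ^{1/2} R e^{Sγ21}`. -/
theorem hasPDeriv_sqrt_smul_mul_expG21 (R : STA) {ρ S : (Fin 4 → ℝ) → ℝ} (hρpos : ∀ x, 0 < ρ x)
    (hρ : Differentiable ℝ ρ) (hS : Differentiable ℝ S) (μ : Fin 4) :
    HasPDeriv μ (fun x => Real.sqrt (ρ x) • R * expG21 (S x)) (fun x =>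
      ((2 : ℝ)⁻¹ * pd μ (fun y => Real.log (ρ y)) x) • (Real.sqrt (ρ x) • R * expG21 (S x))
        + pd μ S x • (Real.sqrt (ρ x) • R * expG21 (S x) * γ21)) := by
  intro L x
  have hsqrt := (hasDerivAt_pd (hρ x) μ).sqrt (by simpa using (hρpos x).ne')
  have hSx := hasDerivAt_pd (hS x) μ
  have h := hsqrt.mul ((hSx.cos.mul_const (L R)).add (hSx.sin.mul_const (L (R * γ21))))
  simp only [pd_log (hρ x) (hρpos x).ne', smul_mul_assoc, mul_expG21_mul_γ21]
  simp only [mul_expG21, map_add, map_sub, map_smul, smul_eq_mul]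
  refine h.congr_deriv ?_
  simp only [zero_smul, add_zero, Pi.add_apply]
  have hpos := Real.sqrt_pos.2 (hρpos x)
  have hsq := Real.sq_sqrt (hρpos x).le
  generalize Real.sqrt (ρ x) = r at hpos hsq ⊢
  rw [← hsq]
  field_simp
  ring

/-- For `ψ(x) = ρ(x)^{1/2} R e^{S(x)γ21}` with `R` constant and `ρ > 0`:
`∂ψ γ21 = ½(∂ ln ρ) ψ γ21 - (∂S) ψ`. -/
theorem statement8 (R : STA)
    (ρ : (Fin 4 → ℝ) → ℝ) (hρpos : ∀ x, 0 < ρ x) (hρ : Differentiable ℝ ρ)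
    (S : (Fin 4 → ℝ) → ℝ) (hS : Differentiable ℝ S)
    (ψ₀ : (Fin 4 → ℝ) → STA) (hψ₀ : ψ₀ = fun x => Real.sqrt (ρ x) • R)
    (ψ : (Fin 4 → ℝ) → STA) (hψ : ψ = fun x => ψ₀ x * expG21 (S x))
    (ψ' : Fin 4 → (Fin 4 → ℝ) → STA) (hψ' : ∀ μ, HasPDeriv μ ψ (ψ' μ))
    (x : Fin 4 → ℝ) :
    ∑ μ, γup μ * ψ' μ x * γ21
      = (2 : ℝ)⁻¹ • ((∑ μ, pd μ (fun y => Real.log (ρ y)) x • γup μ) * ψ x * γ21)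
        - (∑ μ, pd μ S x • γup μ) * ψ x := by
  subst hψ₀ hψ
  have hψ'x (μ : Fin 4) := congrFun ((hψ' μ).unique
    (hasPDeriv_sqrt_smul_mul_expG21 R hρpos hρ hS μ)) x
  simp only [hψ'x]
  generalize Real.sqrt (ρ x) • R * expG21 (S x) = Ψ
  simp only [Finset.sum_mul, Finset.smul_sum, ← Finset.sum_sub_distrib]
  refine Finset.sum_congr rfl fun μ _ => ?_
  rw [mul_assoc, add_mul, smul_mul_assoc, smul_mul_assoc, mul_assoc Ψ, γ21_mul_self, mul_neg_one,
    mul_add, mul_smul_comm, mul_smul_comm, smul_mul_assoc, smul_mul_assoc, smul_smul, mul_neg,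
    smul_neg, sub_eq_add_neg, mul_assoc, smul_mul_assoc]
end
end

section
/- For every element ψ of the even subalgebra of ℝ_{1,3}, the product ψ · ψ̃ of ψ with its reverse lies in the two-dimensional real subspace spanned by 1 and γ5 = γ₀γ₁γ₂γ₃; that is, there exist s, p ∈ ℝ with ψψ̃ = s·1 + p·γ5. -/
noncomputable section
open CliffordAlgebra

/-- The pseudoscalar `γ5 := γ₀γ₁γ₂γ₃`. -/
def γ5 : STA := γ 0 * γ 1 * γ 2 * γ 3

theorem γ_mul_self_s12 (i : Fin 4) : γ i * γ i = algebraMap ℝ STA (ηsgn i) := by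
  rw [γ, ι_sq_scalar]
  congr 1
  fin_cases i <;> simp [Qmink, ηsgn, QuadraticMap.weightedSumSquares_apply, Fin.sum_univ_four]

theorem γ_mul_γ_of_lt {i j : Fin 4} (h : i < j) : γ j * γ i = -(γ i * γ j) := by
  refine eq_neg_of_add_eq_zero_left (ι_mul_ι_add_swap_of_isOrtho ?_)
  rw [QuadraticMap.isOrtho_def]
  fin_cases i <;> fin_cases j <;>
    simp [Qmink, QuadraticMap.weightedSumSquares_apply, Fin.sum_univ_four] at h ⊢

theorem γ_mul_self_mul (i : Fin 4) (x : STA) : γ i * (γ i * x) = ηsgn i • x := by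
  rw [← mul_assoc, γ_mul_self_s12, Algebra.smul_def]

theorem γ_mul_γ_mul_of_lt {i j : Fin 4} (h : i < j) (x : STA) :
    γ j * (γ i * x) = -(γ i * (γ j * x)) := by
  rw [← mul_assoc, γ_mul_γ_of_lt h, neg_mul, mul_assoc]

theorem reverse_γ (i : Fin 4) : reverse (γ i) = γ i := reverse_ι _

theorem ι_eq_sum_γ (m : Fin 4 → ℝ) : ι Qmink m = ∑ i, m i • γ i := by
  conv_lhs => rw [pi_eq_sum_univ' m]
  simp [γ]

/-- The span of the eight ordered products of an even number of the `γ_μ`. -/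
def evenSpan : Submodule ℝ STA :=
  Submodule.span ℝ {1, γ 0 * γ 1, γ 0 * γ 2, γ 0 * γ 3, γ 1 * γ 2, γ 1 * γ 3, γ 2 * γ 3,
    γ 0 * (γ 1 * (γ 2 * γ 3))}

theorem γ_mul_γ_mul_mem_evenSpan (i j : Fin 4) {x : STA} (hx : x ∈ evenSpan) :
    γ i * (γ j * x) ∈ evenSpan := by
  have hgen := Submodule.subset_span (R := ℝ) (s := ({1, γ 0 * γ 1, γ 0 * γ 2, γ 0 * γ 3,
    γ 1 * γ 2, γ 1 * γ 3, γ 2 * γ 3, γ 0 * (γ 1 * (γ 2 * γ 3))} : Set STA))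
  simp only [Set.insert_subset_iff, Set.singleton_subset_iff, SetLike.mem_coe] at hgen
  change _ ∈ evenSpan ∧ _ ∈ evenSpan ∧ _ ∈ evenSpan ∧ _ ∈ evenSpan ∧ _ ∈ evenSpan ∧
    _ ∈ evenSpan ∧ _ ∈ evenSpan ∧ _ ∈ evenSpan at hgen
  induction hx using Submodule.span_induction with
  | zero => simp
  | add x y _ _ hx hy => simpa only [mul_add] using add_mem hx hy
  | smul a x _ hx => simpa only [mul_smul_comm] using evenSpan.smul_mem a hx
  | mem x hx =>
    rcases hx with rfl | rfl | rfl | rfl | rfl | rfl | rfl | rfl <;>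
    fin_cases i <;> fin_cases j <;>
    simp [γ_mul_self_s12, γ_mul_γ_of_lt, γ_mul_self_mul, γ_mul_γ_mul_of_lt, ηsgn, hgen]

theorem evenOdd_zero_le_evenSpan : evenOdd Qmink 0 ≤ evenSpan := by
  intro x hx
  induction x, hx using even_induction with
  | algebraMap r =>
    rw [Algebra.algebraMap_eq_smul_one]
    exact evenSpan.smul_mem r (Submodule.subset_span (by simp))
  | add x y _ _ hx hy => exact add_mem hx hy
  | ι_mul_ι_mul m₁ m₂ x _ hx =>
    simp only [ι_eq_sum_γ, Finset.sum_mul, Finset.mul_sum, smul_mul_assoc, mul_smul_comm,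
      mul_assoc]
    exact sum_mem fun i _ => evenSpan.smul_mem _ <| sum_mem fun j _ => evenSpan.smul_mem _ <|
      γ_mul_γ_mul_mem_evenSpan _ _ hx

theorem add_reverse_mem_span {x : STA} (hx : x ∈ evenSpan) :
    x + reverse x ∈ Submodule.span ℝ {1, γ5} := by
  have h_one : (1 : STA) ∈ Submodule.span ℝ {1, γ5} := Submodule.subset_span (by simp)
  have h_γ5 : γ 0 * (γ 1 * (γ 2 * γ 3)) ∈ Submodule.span ℝ {1, γ5} :=
    Submodule.subset_span (by simp [γ5, mul_assoc])
  induction hx using Submodule.span_induction with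
  | zero => simp
  | add x y _ _ hx hy =>
    rw [map_add, add_add_add_comm]
    exact add_mem hx hy
  | smul a x _ hx =>
    rw [map_smul, ← smul_add]
    exact Submodule.smul_mem _ a hx
  | mem x hx =>
    rcases hx with rfl | rfl | rfl | rfl | rfl | rfl | rfl | rfl <;>
    simp [reverse_γ, reverse.map_mul, γ_mul_γ_of_lt, γ_mul_γ_mul_of_lt, mul_assoc, add_mem,
      h_one, h_γ5]

/-- For every even element `ψ` of the spacetime algebra, `ψ ψ̃` lies in the real span of
`1` and `γ5`: there are `s, p ∈ ℝ` with `ψψ̃ = s·1 + p·γ5`. -/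
theorem statement12 (ψ : STA) (hψ : ψ ∈ evenOdd Qmink 0) :
    ∃ s p : ℝ, ψ * reverse ψ = algebraMap ℝ STA s + p • γ5 := by
  have h_even : ψ * reverse ψ ∈ evenOdd Qmink 0 :=
    evenOdd_mul_le Qmink 0 0 (Submodule.mul_mem_mul hψ ((reverse_mem_evenOdd_iff _).2 hψ))
  obtain ⟨a, b, h⟩ := Submodule.mem_span_pair.1
    (add_reverse_mem_span (evenOdd_zero_le_evenSpan h_even))
  rw [reverse.map_mul, reverse_reverse, ← two_smul ℝ] at h
  refine ⟨a / 2, b / 2, ?_⟩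
  rw [Algebra.algebraMap_eq_smul_one, div_eq_inv_mul, div_eq_inv_mul, mul_smul, mul_smul,
    ← smul_add, h, inv_smul_smul₀ two_ne_zero]
end
end
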